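/- Let E ⊆ ℂ be a nonempty closed set. Suppose there exist positive constants A, C, r₀ and γ, with (log(1/(Ct)))^{−γ} positive and increasing in t on (0, 2r₀), and an increasing function g : (0,∞) → (0,∞) satisfying g(t) = (log(1/(Ct)))^{−γ} for all t ∈ (0, 2r₀), such that Λ_g(E ∩ B̄(a,r)) ≥ A·g(2r) for every a ∈ E and every r ∈ (0, r₀), where B̄(a,r) is the closed disc of center a and radius r. Then E satisfies condition (U)_{1,α} for some α > 1. -/

import Mathlib

open Metric Set
open scoped ENNReal

/-- A set `E ⊆ ℂ` satisfies condition `(U)_{1,α}`. -/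
def CondU1 (E : Set ℂ) (α : ℝ) : Prop :=
  ∃ C > (0 : ℝ), ∃ r₀ > (0 : ℝ), ∀ a ∈ E, ∀ r ∈ Set.Ioo (0 : ℝ) r₀,
    ({z : ℂ | C * r ^ α ≤ dist z a ∧ dist z a ≤ r} ∩ E).Nonempty

/-- The `g`-Hausdorff content of `F ⊆ ℂ`:
`Λ_g(F) = inf { ∑ₖ g(diam Bₖ) : (Bₖ) a countable cover of F by closed discs }`. -/
noncomputable def hContent (g : ℝ → ℝ) (F : Set ℂ) : ℝ≥0∞ :=
  ⨅ (B : ℕ → ℂ × ℝ) (_ : ∀ k, 0 ≤ (B k).2)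
    (_ : F ⊆ ⋃ k, closedBall (B k).1 (B k).2),
    ∑' k, ENNReal.ofReal (g (diam (closedBall (B k).1 (B k).2)))

/-- If, for some `A, C, r₀, γ > 0` with `(log(1/(Ct)))^(−γ)` positive and
increasing on `(0, 2r₀)`, an increasing function `g : (0,∞) → (0,∞)` agreeing
with `(log(1/(Ct)))^(−γ)` on `(0, 2r₀)` satisfies
`Λ_g(E ∩ B̄(a,r)) ≥ A·g(2r)` for all `a ∈ E`, `r ∈ (0, r₀)`, then the
nonempty closed set `E` satisfies `(U)_{1,α}` for some `α > 1`. -/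
theorem stmt_14 (E : Set ℂ) (hne : E.Nonempty) (hcl : IsClosed E)
    (A C r₀ γ : ℝ) (hA : 0 < A) (hC : 0 < C) (hr₀ : 0 < r₀) (hγ : 0 < γ)
    (hpos : ∀ t ∈ Set.Ioo (0 : ℝ) (2 * r₀), 0 < (Real.log (1 / (C * t))) ^ (-γ))
    (hmono : MonotoneOn (fun t : ℝ => (Real.log (1 / (C * t))) ^ (-γ))
      (Set.Ioo (0 : ℝ) (2 * r₀)))
    (g : ℝ → ℝ) (hgpos : ∀ t ∈ Set.Ioi (0 : ℝ), 0 < g t)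
    (hgmono : MonotoneOn g (Set.Ioi (0 : ℝ)))
    (hgeq : ∀ t ∈ Set.Ioo (0 : ℝ) (2 * r₀), g t = (Real.log (1 / (C * t))) ^ (-γ))
    (hcont : ∀ a ∈ E, ∀ r ∈ Set.Ioo (0 : ℝ) r₀,
      ENNReal.ofReal (A * g (2 * r)) ≤ hContent g (E ∩ closedBall a r)) :
    ∃ α > (1 : ℝ), CondU1 E α := by
  -- parameters
  have hg0 : ∀ δ > (0:ℝ), ∃ t > (0:ℝ), g (2 * t) ≤ δ := by
    intro δ hδ
    have h1 : Filter.Tendsto (fun t : ℝ => C * t) (nhdsWithin 0 (Ioi 0)) (nhdsWithin 0 (Ioi 0)) := by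
      apply tendsto_nhdsWithin_of_tendsto_nhds_of_eventually_within
      · have : Filter.Tendsto (fun t : ℝ => C * t) (nhds 0) (nhds (C * 0)) :=
          (continuous_const.mul continuous_id).tendsto 0
        rw [mul_zero] at this
        exact this.mono_left nhdsWithin_le_nhds
      · filter_upwards [self_mem_nhdsWithin] with t ht
        exact mul_pos hC ht
    have h2 : Filter.Tendsto (fun t : ℝ => (Real.log (1 / (C * t))) ^ (-γ))
        (nhdsWithin 0 (Ioi 0)) (nhds 0) := by
      have := (tendsto_rpow_neg_atTop hγ).comp
        (Real.tendsto_log_atTop.comp (tendsto_inv_nhdsGT_zero.comp h1))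
      simpa [Function.comp_def, one_div] using this
    have h3 := h2.eventually (eventually_lt_nhds hδ)
    have h4 : ∀ᶠ t : ℝ in nhdsWithin 0 (Ioi 0), t ∈ Ioo (0:ℝ) (2 * r₀) :=
      Ioo_mem_nhdsGT (by positivity)
    obtain ⟨t, ht, ht'⟩ := (h3.and h4).exists
    refine ⟨t / 2, by linarith [ht'.1], ?_⟩
    rw [show 2 * (t / 2) = t by ring, hgeq t ht']
    exact ht.le
  have key : ∀ a : ℂ, ∀ s > (0:ℝ), ∀ F : Set ℂ, F ⊆ closedBall a s →
      hContent g F ≤ ENNReal.ofReal (g (2 * s)) := by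
    intro a s hs F hF
    apply ENNReal.le_of_forall_pos_le_add
    intro ε hε _
    obtain ⟨e, he, hsum⟩ := ENNReal.exists_pos_sum_of_countable
      (ε := (ε : ℝ≥0∞)) (by exact_mod_cast hε.ne') ℕ
    choose t ht hgt using fun k => hg0 (e k) (by exact_mod_cast he k)
    let B : ℕ → ℂ × ℝ := fun k => Nat.casesOn k (a, s) (fun n => (a, t n))
    have hB : ∀ k, 0 ≤ (B k).2 := by
      intro k
      cases k with
      | zero => exact hs.le
      | succ n => exact (ht n).le
    have hcov : F ⊆ ⋃ k, closedBall (B k).1 (B k).2 :=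
      fun z hz => mem_iUnion.2 ⟨0, hF hz⟩
    have hle : hContent g F ≤
        ∑' k, ENNReal.ofReal (g (diam (closedBall (B k).1 (B k).2))) := by
      unfold hContent
      exact iInf_le_of_le B (iInf_le_of_le hB (iInf_le _ hcov))
    refine hle.trans ?_
    rw [tsum_eq_zero_add' ENNReal.summable]
    have hd : ∀ r : ℝ, 0 ≤ r → diam (closedBall a r) = 2 * r :=
      fun r hr => diam_closedBall_eq a hr
    refine add_le_add ?_ ?_
    · change ENNReal.ofReal (g (diam (closedBall a s))) ≤ _
      rw [hd s hs.le]
    · refine le_trans (ENNReal.tsum_le_tsum fun n => ?_) hsum.le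
      change ENNReal.ofReal (g (diam (closedBall a (t n)))) ≤ _
      rw [hd _ (ht n).le]
      exact ENNReal.ofReal_le_of_le_toReal (by simpa using hgt n)
  set K : ℝ := A ^ (-(1/γ)) with hK
  have hKpos : 0 < K := Real.rpow_pos_of_pos hA _
  set k : ℝ := Real.log (1 / (2 * C)) with hk
  set M : ℝ := |K - 1| * |k| + |k| with hM
  have hM0 : 0 ≤ M := by positivity
  refine ⟨K + 2, by linarith, 1, one_pos, min r₀ (Real.exp (-M)), by positivity, ?_⟩
  intro a ha r hr
  have hr0 : 0 < r := hr.1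
  have hrr : r < r₀ := hr.2.trans_le (min_le_left _ _)
  have hrM : r < Real.exp (-M) := hr.2.trans_le (min_le_right _ _)
  have hr1 : r < 1 := hrM.trans_le (by simpa using hM0)
  by_contra hemp
  rw [Set.not_nonempty_iff_eq_empty] at hemp
  have hs : 0 < r ^ (K + 2) := Real.rpow_pos_of_pos hr0 _
  have hsr : r ^ (K + 2) ≤ r := by
    simpa using Real.rpow_le_rpow_of_exponent_ge hr0 hr1.le (show (1:ℝ) ≤ K + 2 by linarith)
  have hsub : E ∩ closedBall a r ⊆ closedBall a (r ^ (K + 2)) := by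
    rintro z ⟨hz, hzr⟩
    by_contra hn
    have : z ∈ ({z : ℂ | 1 * r ^ (K + 2) ≤ dist z a ∧ dist z a ≤ r} ∩ E) := by
      refine ⟨⟨?_, hzr⟩, hz⟩
      rw [mem_closedBall, not_le] at hn
      linarith
    rw [hemp] at this
    exact this
  have h1 := (hcont a ha r ⟨hr0, hrr⟩).trans (key a _ hs _ hsub)
  rw [ENNReal.ofReal_le_ofReal_iff (hgpos _ (by simpa using hs)).le,
    hgeq _ ⟨by positivity, by linarith⟩, hgeq _ ⟨by positivity, by linarith⟩] at h1
  have hl1 : Real.log (1 / (C * (2 * r))) = k - Real.log r := by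
    rw [hk, ← Real.log_div (by positivity) hr0.ne']
    congr 1
    field_simp
  have hl2 : Real.log (1 / (C * (2 * r ^ (K + 2)))) = k - (K + 2) * Real.log r := by
    rw [hk, ← Real.log_rpow hr0, ← Real.log_div (by positivity) hs.ne']
    congr 1
    field_simp
  rw [hl1, hl2] at h1
  have hL : M < - Real.log r := by
    have := (Real.log_lt_iff_lt_exp hr0).2 hrM
    linarith
  set L : ℝ := - Real.log r with hLdef
  have e1 : k - Real.log r = k + L := by rw [hLdef]; ring
  have e2 : k - (K + 2) * Real.log r = k + (K + 2) * L := by rw [hLdef]; ring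
  rw [e1, e2] at h1
  have hp0 : 0 ≤ |K - 1| * |k| := by positivity
  have hkabs := neg_abs_le k
  have hpos1 : 0 < k + L := by linarith
  have hKk : (K - 1) * k ≤ |K - 1| * |k| := by rw [← abs_mul]; exact le_abs_self _
  have hL0 : 0 < L := by linarith
  have hlt : K * (k + L) < k + (K + 2) * L := by
    have := abs_nonneg k
    nlinarith
  have h2 : (k + (K + 2) * L) ^ (-γ) < (K * (k + L)) ^ (-γ) :=
    Real.rpow_lt_rpow_of_neg (by positivity) hlt (by linarith)
  have h3 : (K * (k + L)) ^ (-γ) = A * (k + L) ^ (-γ) := by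
    rw [Real.mul_rpow hKpos.le hpos1.le, hK, ← Real.rpow_mul hA.le]
    have : -(1 / γ) * -γ = 1 := by field_simp
    rw [this, Real.rpow_one]
  linarith
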